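/- Let S be a semigroup having an embeddable *-pair P = (≤_l, ≤_r). Then there exists a semigroup Q containing S as a subsemigroup such that S is a straight left order in Q and Q induces P, if and only if P satisfies conditions (Gi) and (Gii). -/

import Mathlib

universe u

variable {Q : Type u}

/-- `p ≤_L q` in a semigroup `Q`: `Q¹p ⊆ Q¹q`, i.e. `p = q` or `p = x*q` for some `x`. -/
def leL [Semigroup Q] (p q : Q) : Prop := p = q ∨ ∃ x, p = x * q

/-- `p ≤_R q` in a semigroup `Q`: `pQ¹ ⊆ qQ¹`. -/
def leR [Semigroup Q] (p q : Q) : Prop := p = q ∨ ∃ x, p = q * x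

/-- Green's relation `L`. -/
def GreenL [Semigroup Q] (p q : Q) : Prop := leL p q ∧ leL q p

/-- Green's relation `R`. -/
def GreenR [Semigroup Q] (p q : Q) : Prop := leR p q ∧ leR q p

/-- Green's relation `H = L ∩ R`. -/
def GreenH [Semigroup Q] (p q : Q) : Prop := GreenL p q ∧ GreenR p q

/-- Green's relation `D = L ∘ R`. -/
def GreenD [Semigroup Q] (p q : Q) : Prop := ∃ c, GreenL p c ∧ GreenR c q

/-- `h` is the group inverse `q♯` of `q` (in the group `H`-class of `q`):
`q` and `h` commute, `qhq = q` and `hqh = h`.  This holds precisely when `q` lies in a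
subgroup of `Q` and `h` is its group inverse there. -/
def IsGroupInverse [Semigroup Q] (q h : Q) : Prop :=
  q * h = h * q ∧ q * h * q = q ∧ h * q * h = h

/-- `q` lies in a subgroup of `Q` (i.e. `q ∈ H(Q)`, the `H`-class of `q` is a group). -/
def inSubgroup [Semigroup Q] (q : Q) : Prop := ∃ h, IsGroupInverse q h

/-- A semigroup is regular if every element `q` can be written `q = qxq`. -/
def Regular (Q : Type u) [Semigroup Q] : Prop := ∀ q : Q, ∃ x, q * x * q = q

variable {S : Type u}

/-- `a ≤_{L*} b` in a semigroup `S`: for all `x, y ∈ S¹`, `bx = by` implies `ax = ay`. -/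
def leLstar [Semigroup S] (a b : S) : Prop :=
  ∀ x y : WithOne S, (b : WithOne S) * x = (b : WithOne S) * y →
    (a : WithOne S) * x = (a : WithOne S) * y

/-- `a ≤_{R*} b` in a semigroup `S`: for all `x, y ∈ S¹`, `xb = yb` implies `xa = ya`. -/
def leRstar [Semigroup S] (a b : S) : Prop :=
  ∀ x y : WithOne S, x * (b : WithOne S) = y * (b : WithOne S) →
    x * (a : WithOne S) = y * (a : WithOne S)

/-- `a` is square cancellable: `a H* a²`, i.e. `a L* a²` and `a R* a²`. -/
def SqC [Semigroup S] (a : S) : Prop :=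
  leLstar a (a * a) ∧ leLstar (a * a) a ∧ leRstar a (a * a) ∧ leRstar (a * a) a

/-- `S(S)`, the set of square cancellable elements of `S`. -/
def SqSet (S : Type u) [Semigroup S] : Set S := { a | SqC a }

/-- `(lel, ler)` is a `*`-pair for `S`: both are preorders, `lel` is right compatible
with multiplication, `ler` is left compatible, `lel ⊆ ≤_{L*}` and `ler ⊆ ≤_{R*}`. -/
def IsStarPair [Semigroup S] (lel ler : S → S → Prop) : Prop :=
  (∀ a, lel a a) ∧ (∀ a b c, lel a b → lel b c → lel a c) ∧
  (∀ a, ler a a) ∧ (∀ a b c, ler a b → ler b c → ler a c) ∧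
  (∀ a b c, lel a b → lel (a * c) (b * c)) ∧
  (∀ a b c, ler a b → ler (c * a) (c * b)) ∧
  (∀ a b, lel a b → leLstar a b) ∧
  (∀ a b, ler a b → leRstar a b)

/-- The equivalence `L'` associated with `lel`. -/
def Lp [Semigroup S] (lel : S → S → Prop) (a b : S) : Prop := lel a b ∧ lel b a

/-- The equivalence `R'` associated with `ler`. -/
def Rp [Semigroup S] (ler : S → S → Prop) (a b : S) : Prop := ler a b ∧ ler b a

/-- `H' = L' ∩ R'`. -/
def Hp [Semigroup S] (lel ler : S → S → Prop) (a b : S) : Prop :=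
  Lp lel a b ∧ Rp ler a b

/-- `G(S) = { a ∈ S : a H' a² }`. -/
def GS [Semigroup S] (lel ler : S → S → Prop) : Set S := { a | Hp lel ler a (a * a) }

/-- Condition (Ei): `L' ∘ R' = R' ∘ L'`. -/
def CondEi [Semigroup S] (lel ler : S → S → Prop) : Prop :=
  ∀ a b : S, (∃ c, Lp lel a c ∧ Rp ler c b) ↔ (∃ c, Rp ler a c ∧ Lp lel c b)

/-- Condition (Eii)(l): `b ≤_l c` iff `b L' dc` for some `d ∈ S`. -/
def CondEiiL [Semigroup S] (lel : S → S → Prop) : Prop :=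
  ∀ b c : S, lel b c ↔ ∃ d, Lp lel b (d * c)

/-- Condition (Eii)(r): `b ≤_r c` iff `b R' cd` for some `d ∈ S`. -/
def CondEiiR [Semigroup S] (ler : S → S → Prop) : Prop :=
  ∀ b c : S, ler b c ↔ ∃ d, Rp ler b (c * d)

/-- Condition (Eiii): every `L'`-class and every `R'`-class contains an element of
`G(S)`. -/
def CondEiii [Semigroup S] (lel ler : S → S → Prop) : Prop :=
  (∀ a : S, ∃ g ∈ GS lel ler, Lp lel a g) ∧ (∀ a : S, ∃ g ∈ GS lel ler, Rp ler a g)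

/-- Condition (Ev)(l): for `a ∈ G(S)` and `b ∈ S`, `b ≤_l a` implies `ba R' b`. -/
def CondEvL [Semigroup S] (lel ler : S → S → Prop) : Prop :=
  ∀ a ∈ GS lel ler, ∀ b : S, lel b a → Rp ler (b * a) b

/-- Condition (Ev)(r): for `a ∈ G(S)` and `b ∈ S`, `b ≤_r a` implies `ab L' b`. -/
def CondEvR [Semigroup S] (lel ler : S → S → Prop) : Prop :=
  ∀ a ∈ GS lel ler, ∀ b : S, ler b a → Lp lel (a * b) b

/-- Condition (Evi)(l): for `a ∈ G(S)`, `b, c ≤_l a` and `ba = ca` imply `b = c`. -/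
def CondEviL [Semigroup S] (lel ler : S → S → Prop) : Prop :=
  ∀ a ∈ GS lel ler, ∀ b c : S, lel b a → lel c a → b * a = c * a → b = c

/-- Condition (Evi)(r): for `a ∈ G(S)`, `b, c ≤_r a` and `ab = ac` imply `b = c`. -/
def CondEviR [Semigroup S] (lel ler : S → S → Prop) : Prop :=
  ∀ a ∈ GS lel ler, ∀ b c : S, ler b a → ler c a → a * b = a * c → b = c

/-- Condition (Evii)(l): for `a ∈ G(S)`, `b, c ≤_l a` and `ba L' ca` imply `b L' c`. -/
def CondEviiL [Semigroup S] (lel ler : S → S → Prop) : Prop :=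
  ∀ a ∈ GS lel ler, ∀ b c : S, lel b a → lel c a → Lp lel (b * a) (c * a) → Lp lel b c

/-- Condition (Evii)(r): for `a ∈ G(S)`, `b, c ≤_r a` and `ab R' ac` imply `b R' c`. -/
def CondEviiR [Semigroup S] (lel ler : S → S → Prop) : Prop :=
  ∀ a ∈ GS lel ler, ∀ b c : S, ler b a → ler c a → Rp ler (a * b) (a * c) → Rp ler b c

/-- An embeddable `*`-pair: a `*`-pair satisfying (Ei), (Eii), (Eiii), (Ev), (Evi) and
(Evii) (left and right versions). -/
def IsEmbeddableStarPair [Semigroup S] (lel ler : S → S → Prop) : Prop :=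
  IsStarPair lel ler ∧ CondEi lel ler ∧ CondEiiL lel ∧ CondEiiR ler ∧
  CondEiii lel ler ∧ CondEvL lel ler ∧ CondEvR lel ler ∧
  CondEviL lel ler ∧ CondEviR lel ler ∧ CondEviiL lel ler ∧ CondEviiR lel ler

/-- Condition (Gi): `S(S) = G(S)`. -/
def CondGi [Semigroup S] (lel ler : S → S → Prop) : Prop := SqSet S = GS lel ler

/-- Condition (Gii): for every square cancellable `a`, the `H'`-class of `a` is right
reversible: for all `x, y H' a` there exist `u, v H' a` with `ux = vy`. -/
def CondGii [Semigroup S] (lel ler : S → S → Prop) : Prop :=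
  ∀ a ∈ SqSet S, ∀ x y : S, Hp lel ler x a → Hp lel ler y a →
    ∃ u v : S, Hp lel ler u a ∧ Hp lel ler v a ∧ u * x = v * y

/-- Condition (Gii)': for every square cancellable `a`, the `H'`-class of `a` is left
reversible: for all `x, y H' a` there exist `u, v H' a` with `xu = yv`. -/
def CondGii' [Semigroup S] (lel ler : S → S → Prop) : Prop :=
  ∀ a ∈ SqSet S, ∀ x y : S, Hp lel ler x a → Hp lel ler y a →
    ∃ u v : S, Hp lel ler u a ∧ Hp lel ler v a ∧ x * u = y * v

/-- `Q` (a semigroup) together with the injective multiplicative embedding `f` realises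
`S` as a subsemigroup of `Q` which is a straight left order in `Q`, and `Q` induces the
`*`-pair `(lel, ler)` on `S`: (a) every element of `Q` is `a♯ * b` with `a, b ∈ S` and
`a R b` in `Q`; (b) every square cancellable element of `S` lies in a subgroup of `Q`;
(c) for `b, c ∈ S`, `b ≤_l c` iff `b ≤_L c` in `Q`, and `b ≤_r c` iff `b ≤_R c` in
`Q`. -/
def StraightLeftOrderExtension [Semigroup S] (lel ler : S → S → Prop)
    (Q : Type u) [Semigroup Q] (f : S → Q) : Prop :=
  Function.Injective f ∧ (∀ a b : S, f (a * b) = f a * f b) ∧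
  (∀ q : Q, ∃ a b : S, (∃ c, IsGroupInverse (f a) c ∧ q = c * f b) ∧ GreenR (f a) (f b)) ∧
  (∀ a : S, SqC a → inSubgroup (f a)) ∧
  (∀ b c : S, (lel b c ↔ leL (f b) (f c)) ∧ (ler b c ↔ leR (f b) (f c)))

/-- As in `StraightLeftOrderExtension`, but `S` is moreover a straight right order in
`Q`: every element of `Q` is `b * a♯` with `a, b ∈ S` and `a L b` in `Q`. -/
def StraightOrderExtension [Semigroup S] (lel ler : S → S → Prop)
    (Q : Type u) [Semigroup Q] (f : S → Q) : Prop :=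
  StraightLeftOrderExtension lel ler Q f ∧
  (∀ q : Q, ∃ a b : S, (∃ c, IsGroupInverse (f a) c ∧ q = f b * c) ∧ GreenL (f a) (f b))

/-! ### Pairs of preorders with an Ore condition on the group-like `H'`-classes -/

/-- The properties of an embeddable `*`-pair satisfying (Gi) and (Gii) from which a semigroup of
straight left quotients is built. -/
structure OrePair [Semigroup S] (lel ler : S → S → Prop) : Prop where
  lel_refl : ∀ a, lel a a
  lel_trans : ∀ {a b c}, lel a b → lel b c → lel a c
  ler_refl : ∀ a, ler a a
  ler_trans : ∀ {a b c}, ler a b → ler b c → ler a c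
  lel_mul : ∀ {a b} (c), lel a b → lel (a * c) (b * c)
  ler_mul : ∀ {a b} (c), ler a b → ler (c * a) (c * b)
  cancel : ∀ {a b x y : S}, ler a b → x * b = y * b → x * a = y * a
  comm : ∀ {a b c}, Lp lel a b → Rp ler b c → ∃ d, Rp ler a d ∧ Lp lel d c
  comm' : ∀ {a b c}, Rp ler a b → Lp lel b c → ∃ d, Lp lel a d ∧ Rp ler d c
  lel_iff : ∀ {b c}, lel b c ↔ ∃ d, Lp lel b (d * c)
  ler_iff : ∀ {b c}, ler b c ↔ ∃ d, Rp ler b (c * d)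
  exists_Lp : ∀ a, ∃ g ∈ GS lel ler, Lp lel a g
  exists_Rp : ∀ a, ∃ g ∈ GS lel ler, Rp ler a g
  mul_Rp : ∀ {a b}, a ∈ GS lel ler → lel b a → Rp ler (b * a) b
  mul_Lp : ∀ {a b}, a ∈ GS lel ler → ler b a → Lp lel (a * b) b
  right_cancel : ∀ {a b c}, a ∈ GS lel ler → lel b a → lel c a → b * a = c * a → b = c
  left_cancel : ∀ {a b c}, a ∈ GS lel ler → ler b a → ler c a → a * b = a * c → b = c
  Rp_cancel : ∀ {a b c}, a ∈ GS lel ler → ler b a → ler c a →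
    Rp ler (a * b) (a * c) → Rp ler b c
  ore : ∀ {a x y}, a ∈ GS lel ler → Hp lel ler x a → Hp lel ler y a →
    ∃ u v, Hp lel ler u a ∧ Hp lel ler v a ∧ u * x = v * y

theorem IsEmbeddableStarPair.orePair [Semigroup S] {lel ler : S → S → Prop}
    (h : IsEmbeddableStarPair lel ler) (hi : CondGi lel ler) (hii : CondGii lel ler) :
    OrePair lel ler := by
  obtain ⟨⟨h1, h2, h3, h4, h5, h6, -, h8⟩, hEi, hl, hr, ⟨hgl, hgr⟩, e1, e2, e3, e4, -, e5⟩ := h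
  exact
    { lel_refl := h1
      lel_trans := fun {a b c} => h2 a b c
      ler_refl := h3
      ler_trans := fun {a b c} => h4 a b c
      lel_mul := fun {a b} c => h5 a b c
      ler_mul := fun {a b} c => h6 a b c
      cancel := fun {a b x y} hab hxy => by
        have := h8 a b hab x y (by exact_mod_cast hxy)
        exact_mod_cast this
      comm := fun {a b c} hab hbc => (hEi a c).1 ⟨b, hab, hbc⟩
      comm' := fun {a b c} hab hbc => (hEi a c).2 ⟨b, hab, hbc⟩
      lel_iff := fun {b c} => hl b c
      ler_iff := fun {b c} => hr b c
      exists_Lp := hgl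
      exists_Rp := hgr
      mul_Rp := fun {a b} ha => e1 a ha b
      mul_Lp := fun {a b} ha => e2 a ha b
      right_cancel := fun {a b c} ha => e3 a ha b c
      left_cancel := fun {a b c} ha => e4 a ha b c
      Rp_cancel := fun {a b c} ha => e5 a ha b c
      ore := fun {a x y} ha => hii a (by rw [hi]; exact ha) x y }

namespace OrePair

variable [Semigroup S] {lel ler : S → S → Prop}

section Basic

theorem Lp_refl (h : OrePair lel ler) (a : S) : Lp lel a a := ⟨h.lel_refl a, h.lel_refl a⟩

theorem Rp_refl (h : OrePair lel ler) (a : S) : Rp ler a a := ⟨h.ler_refl a, h.ler_refl a⟩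

theorem Hp_refl (h : OrePair lel ler) (a : S) : Hp lel ler a a := ⟨h.Lp_refl a, h.Rp_refl a⟩

theorem Lp_trans (h : OrePair lel ler) {a b c : S} (hab : Lp lel a b) (hbc : Lp lel b c) :
    Lp lel a c :=
  ⟨h.lel_trans hab.1 hbc.1, h.lel_trans hbc.2 hab.2⟩

theorem Rp_trans (h : OrePair lel ler) {a b c : S} (hab : Rp ler a b) (hbc : Rp ler b c) :
    Rp ler a c :=
  ⟨h.ler_trans hab.1 hbc.1, h.ler_trans hbc.2 hab.2⟩

theorem Hp_trans (h : OrePair lel ler) {a b c : S} (hab : Hp lel ler a b)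
    (hbc : Hp lel ler b c) : Hp lel ler a c :=
  ⟨h.Lp_trans hab.1 hbc.1, h.Rp_trans hab.2 hbc.2⟩

theorem Hp_symm {a b : S} (hab : Hp lel ler a b) : Hp lel ler b a :=
  ⟨hab.1.symm, hab.2.symm⟩

theorem Lp_mul (h : OrePair lel ler) {a b : S} (c : S) (hab : Lp lel a b) :
    Lp lel (a * c) (b * c) :=
  ⟨h.lel_mul c hab.1, h.lel_mul c hab.2⟩

theorem Rp_mul (h : OrePair lel ler) {a b : S} (c : S) (hab : Rp ler a b) :
    Rp ler (c * a) (c * b) :=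
  ⟨h.ler_mul c hab.1, h.ler_mul c hab.2⟩

theorem mul_lel (h : OrePair lel ler) (d c : S) : lel (d * c) c :=
  h.lel_iff.2 ⟨d, h.Lp_refl _⟩

theorem mul_ler (h : OrePair lel ler) (c d : S) : ler (c * d) c :=
  h.ler_iff.2 ⟨d, h.Rp_refl _⟩

theorem mul_Rp_left (h : OrePair lel ler) {a p q : S} (ha : a ∈ GS lel ler) (hp : lel p a)
    (hq : Rp ler q a) : Rp ler (p * q) p :=
  h.Rp_trans (h.Rp_mul p hq) (h.mul_Rp ha hp)

theorem mul_Lp_right (h : OrePair lel ler) {a p q : S} (ha : a ∈ GS lel ler) (hp : Lp lel p a)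
    (hq : ler q a) : Lp lel (p * q) q :=
  h.Lp_trans (h.Lp_mul q hp) (h.mul_Lp ha hq)

theorem Hp_mul (h : OrePair lel ler) {c x y : S} (hc : c ∈ GS lel ler) (hx : Hp lel ler x c)
    (hy : Hp lel ler y c) : Hp lel ler (x * y) c :=
  ⟨h.Lp_trans (h.mul_Lp_right hc hx.1 hy.2.1) hy.1,
    h.Rp_trans (h.mul_Rp_left hc hx.1.1 hy.2) hx.2⟩

theorem mem_GS (h : OrePair lel ler) {c x : S} (hc : c ∈ GS lel ler) (hx : Hp lel ler x c) :
    x ∈ GS lel ler :=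
  h.Hp_trans hx (Hp_symm (h.Hp_mul hc hx hx))

end Basic

section CommonMultiples

theorem exists_mul_Hp (h : OrePair lel ler) {w c : S} (hw : Rp ler w c) :
    ∃ g ∈ GS lel ler, ∃ k, Lp lel w g ∧ Rp ler g k ∧
      ∀ w', Hp lel ler w' w → Hp lel ler (w' * k) c := by
  obtain ⟨g, hg, hwg⟩ := h.exists_Lp w
  obtain ⟨k, hgk, hkc⟩ := h.comm hwg.symm hw
  refine ⟨g, hg, k, hwg, hgk, fun w' hw' => ⟨?_, ?_⟩⟩
  · have hl : Lp lel w' g := h.Lp_trans hw'.1 hwg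
    exact h.Lp_trans (h.mul_Lp_right hg hl hgk.2) hkc
  · have hl : lel w' g := h.lel_trans hw'.1.1 hwg.1
    exact h.Rp_trans (h.mul_Rp_left hg hl hgk.symm) (h.Rp_trans hw'.2 hw)

theorem exists_mul_eq_of_Hp (h : OrePair lel ler) {w w' c : S} (hc : c ∈ GS lel ler)
    (hw : Rp ler w c) (hww : Hp lel ler w' w) :
    ∃ x x', Hp lel ler x c ∧ Hp lel ler x' c ∧ x * w = x' * w' := by
  obtain ⟨g, hg, k, hwg, hgk, H⟩ := h.exists_mul_Hp hw
  obtain ⟨x, x', hx, hx', e⟩ := h.ore hc (H w (h.Hp_refl w)) (H w' hww)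
  refine ⟨x, x', hx, hx', ?_⟩
  rw [← mul_assoc, ← mul_assoc] at e
  exact h.right_cancel hg (h.lel_trans (h.mul_lel x w) hwg.1)
    (h.lel_trans (h.mul_lel x' w') (h.lel_trans hww.1.1 hwg.1)) (h.cancel hgk.1 e)

theorem exists_mul_eq_of_Lp (h : OrePair lel ler) {w v c : S} (hc : c ∈ GS lel ler)
    (hw : Rp ler w c) (hwv : Lp lel w v) :
    ∃ x m, Hp lel ler x c ∧ x * w = m * v := by
  obtain ⟨d, hd, hvd⟩ := h.exists_Rp v
  obtain ⟨k, hk, hkw⟩ := h.comm' hvd.symm hwv.symm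
  have hkv : Hp lel ler (k * v) w :=
    ⟨h.Lp_trans (h.mul_Lp_right hd hk.symm hvd.1) hwv.symm,
      h.Rp_trans (h.mul_Rp_left hd hk.2 hvd) hkw⟩
  obtain ⟨x, x', hx, -, e⟩ := h.exists_mul_eq_of_Hp hc hw hkv
  exact ⟨x, x' * k, hx, by rw [e, mul_assoc]⟩

/-- In a semigroup of quotients, `p * a♯ = x♯ * y`. -/
theorem exists_quotient (h : OrePair lel ler) {a c p : S} (ha : a ∈ GS lel ler)
    (hc : c ∈ GS lel ler) (hpc : Rp ler (p * a) c) :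
    ∃ x y, Hp lel ler x c ∧ Rp ler y c ∧ lel y a ∧ x * (p * a) = y * a * a := by
  have h2 : lel (p * a) (a * a * a) :=
    h.lel_trans (h.mul_lel p a) (h.lel_trans ha.1.1 (h.lel_mul a ha.1.1))
  obtain ⟨d, hd⟩ := h.lel_iff.1 h2
  have hda : lel (d * a) a := h.mul_lel d a
  have e1 : Rp ler (d * (a * a * a)) (d * a) := by
    have i1 : Rp ler (d * a * a * a) (d * a * a) := h.mul_Rp ha (h.mul_lel _ a)
    have i2 := h.Rp_trans i1 (h.mul_Rp ha hda)
    simpa only [mul_assoc] using i2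
  obtain ⟨t, hwt, htd⟩ := h.comm hd e1
  have hta : lel t a := h.lel_trans htd.1 hda
  have hH : Hp lel ler (t * a * a) (p * a) := by
    refine ⟨?_, ?_⟩
    · have := h.Lp_mul a (h.Lp_mul a htd)
      refine h.Lp_trans this ?_
      simpa only [Lp, mul_assoc] using hd.symm
    · exact h.Rp_trans (h.mul_Rp ha (h.mul_lel t a)) (h.Rp_trans (h.mul_Rp ha hta) hwt.symm)
  obtain ⟨x, x', hx, hx', e⟩ := h.exists_mul_eq_of_Hp hc hpc hH
  refine ⟨x, x' * t, hx, ?_, h.lel_trans (h.mul_lel x' t) hta, ?_⟩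
  · exact h.Rp_trans (h.mul_Rp_left hc hx'.1.1 (h.Rp_trans hwt.symm hpc)) hx'.2
  · rw [e]; simp only [mul_assoc]

/-- In a semigroup of quotients, `a♯ * x` is `R`-related to some `z ∈ G(S)` with `z ≤_r a`. -/
theorem exists_Rp_quotient (h : OrePair lel ler) {a x : S} (ha : a ∈ GS lel ler)
    (hx : ler x a) :
    ∃ z ∈ GS lel ler, ∃ s, Rp ler x (a * a * s) ∧ Rp ler z (a * s) ∧ ler z a ∧
      Rp ler (z * a) z := by
  obtain ⟨s, hs⟩ := h.ler_iff.1 (h.ler_trans hx ha.2.1)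
  obtain ⟨z, hz, hzs⟩ := h.exists_Rp (a * s)
  refine ⟨z, hz, s, hs, hzs.symm, h.ler_trans hzs.2 (h.mul_ler a s), h.mul_ler z a, ?_⟩
  have e : Rp ler z (z * (a * s)) := h.Rp_trans hz.2 (h.Rp_mul z hzs.symm)
  rw [← mul_assoc] at e
  exact h.ler_trans e.1 (h.mul_ler _ s)

theorem mul_Rp_of_quotient (h : OrePair lel ler) {a g p s x z : S} (hz : z ∈ GS lel ler)
    (hg : Hp lel ler g z) (hx : Rp ler x (a * a * s)) (hzs : Rp ler z (a * s))
    (e : g * (z * a) = p * a * a) : Rp ler (p * x) z := by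
  have hgz := h.Hp_mul hz hg (h.Hp_refl z)
  have e1 : p * (a * a * s) = g * z * (a * s) := by
    rw [← mul_assoc, ← mul_assoc, ← e]; simp only [mul_assoc]
  have i := h.Rp_mul p hx
  rw [e1] at i
  exact h.Rp_trans i (h.Rp_trans (h.mul_Rp_left hz hgz.1.1 hzs.symm) hgz.2)

end CommonMultiples

end OrePair

/-! ### The semigroup of straight left quotients inside a representation -/

theorem IsGroupInverse.sq [Semigroup Q] {q h : Q} (hq : IsGroupInverse q h) :
    IsGroupInverse (q * q) (h * h) := by
  obtain ⟨h1, h2, h3⟩ := hq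
  have e : q * q * (h * h) = q * h := by
    rw [mul_assoc, ← mul_assoc q h h, h1, h3, h1]
  have e' : h * h * (q * q) = h * q := by
    rw [mul_assoc, ← mul_assoc h q q, ← h1, h2, h1]
  refine ⟨by rw [e, e', h1], ?_, ?_⟩
  · rw [e, ← mul_assoc, h2]
  · rw [e', ← mul_assoc, h3]

/-- A faithful representation of `S` in which the elements of `G(S)` become group elements acting
as they would in a semigroup of straight left quotients of `S`. -/
structure IsQuotientRep [Semigroup S] {T : Type u} [Semigroup T] (lel ler : S → S → Prop)
    (f : S → T) : Prop where
  map_mul : ∀ a b, f (a * b) = f a * f b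
  injective : Function.Injective f
  exists_inv : ∀ {a}, a ∈ GS lel ler → inSubgroup (f a)
  inv_mul_mul : ∀ {a b h}, a ∈ GS lel ler → ler b a → IsGroupInverse (f a) h →
    h * (f a * f b) = f b
  ler_of_leR : ∀ {b c}, leR (f b) (f c) → ler b c

/-- `q` is a straight left quotient with denominator below `a`. -/
def IsQuotientBelow [Semigroup S] {T : Type u} [Semigroup T] (lel ler : S → S → Prop)
    (f : S → T) (a : S) (q : T) : Prop :=
  ∃ z ∈ GS lel ler, ler z a ∧ ∃ v, Rp ler v z ∧ ∃ k, IsGroupInverse (f z) k ∧ q = k * f v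

namespace IsQuotientRep

variable [Semigroup S] {T : Type u} [Semigroup T] {lel ler : S → S → Prop} {f : S → T}

theorem exists_eq_mul_of_ler (F : IsQuotientRep lel ler f) (h : OrePair lel ler) {b c : S}
    (hbc : ler b c) :
    ∃ m, ∃ g ∈ GS lel ler, ∃ k, IsGroupInverse (f g) k ∧ f b = f c * (f m * (k * f b)) := by
  obtain ⟨d, hd⟩ := h.ler_iff.1 hbc
  obtain ⟨e, he, hce⟩ := h.exists_Rp (c * d)
  obtain ⟨-, -, m, -, -, H⟩ := h.exists_mul_Hp hce
  have hg := H _ (h.Hp_refl _)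
  have hgG := h.mem_GS he hg
  obtain ⟨k, hk⟩ := F.exists_inv hgG
  refine ⟨d * m, _, hgG, k, hk, ?_⟩
  have hb : ler b (c * d * m) := h.ler_trans hd.1 (h.ler_trans hce.1 hg.2.2)
  have := F.inv_mul_mul hgG hb hk
  rw [← mul_assoc, ← hk.1] at this
  rw [← mul_assoc, ← mul_assoc, ← F.map_mul, ← mul_assoc, this]

theorem exists_eq_mul_of_lel (F : IsQuotientRep lel ler f) (h : OrePair lel ler) {b c : S}
    (hbc : lel b c) :
    ∃ m, ∃ g ∈ GS lel ler, ∃ k, IsGroupInverse (f g) k ∧ f b = k * f m * f c := by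
  obtain ⟨d, hd⟩ := h.lel_iff.1 hbc
  obtain ⟨e, he, hbe⟩ := h.exists_Rp b
  obtain ⟨x, m, hx, hm⟩ := h.exists_mul_eq_of_Lp he hbe hd
  have hxG := h.mem_GS he hx
  obtain ⟨k, hk⟩ := F.exists_inv hxG
  refine ⟨m * d, x, hxG, k, hk, ?_⟩
  have := F.inv_mul_mul hxG (h.ler_trans hbe.1 hx.2.2) hk
  rw [← F.map_mul, hm, ← mul_assoc, F.map_mul, ← mul_assoc] at this
  exact this.symm

theorem mul_mul_inv (F : IsQuotientRep lel ler f) (h : OrePair lel ler) {p a : S} {k : T}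
    (hpa : lel p a) (hk : IsGroupInverse (f a) k) : f p * (f a * k) = f p := by
  obtain ⟨m, -, -, l, -, e⟩ := F.exists_eq_mul_of_lel h hpa
  rw [e, mul_assoc, ← mul_assoc (f a) (f a) k, mul_assoc (f a) (f a) k, hk.1, ← mul_assoc (f a),
    hk.2.1]

theorem inv_mul_mul' (F : IsQuotientRep lel ler f) {a b : S} {k t q : T}
    (ha : a ∈ GS lel ler) (hba : ler b a) (hk : IsGroupInverse (f a) k) (hq : q = f b * t) :
    k * (f a * q) = q := by
  rw [hq, ← mul_assoc (f a), ← mul_assoc, F.inv_mul_mul ha hba hk]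

theorem exists_mul_inv_eq (F : IsQuotientRep lel ler f) (h : OrePair lel ler) {a c p : S} {k : T}
    (ha : a ∈ GS lel ler) (hc : c ∈ GS lel ler) (hk : IsGroupInverse (f a) k)
    (hpc : Rp ler (p * a) c) :
    ∃ x y, Hp lel ler x c ∧ Rp ler y c ∧ lel y a ∧ x * (p * a) = y * a * a ∧
      f x * (f p * k) = f y := by
  obtain ⟨x, y, hx, hy, hya, e⟩ := h.exists_quotient ha hc hpc
  refine ⟨x, y, hx, hy, hya, e, ?_⟩
  have hk' : k = f a * k * k := by rw [hk.1, hk.2.2]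
  have e' := congrArg f e
  simp only [F.map_mul] at e'
  have e1 := F.mul_mul_inv h hya hk
  calc f x * (f p * k) = f x * (f p * (f a * k * k)) := by rw [← hk']
    _ = f x * (f p * f a) * k * k := by simp only [mul_assoc]
    _ = f y * (f a * (f a * k)) * k := by rw [e']; simp only [mul_assoc]
    _ = f y * (f a * k) := by rw [hk.1, ← mul_assoc (f a), hk.2.1, mul_assoc, hk.1]
    _ = f y := e1

theorem exists_inv_mul_eq (F : IsQuotientRep lel ler f) (h : OrePair lel ler) {a x s z : S}
    {k t : T} (ha : a ∈ GS lel ler) (hk : IsGroupInverse (f a) k) (hx : ler x (a * a * s))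
    (hz : ler (a * s) z) : ∃ t', k * (f x * t) = f z * t' := by
  obtain ⟨u, hu⟩ : ∃ u, f x = f (a * a * s) * u :=
    let ⟨_, _, _, _, _, e⟩ := F.exists_eq_mul_of_ler h hx
    ⟨_, e⟩
  obtain ⟨u', hu'⟩ : ∃ u, f (a * s) = f z * u :=
    let ⟨_, _, _, _, _, e⟩ := F.exists_eq_mul_of_ler h hz
    ⟨_, e⟩
  have e1 : k * f (a * a * s) = f (a * s) := by
    rw [mul_assoc, F.map_mul]
    exact F.inv_mul_mul ha (h.mul_ler a s) hk
  exact ⟨u' * u * t, by rw [hu, ← mul_assoc, ← mul_assoc, e1, hu']; simp only [mul_assoc]⟩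

theorem isQuotientBelow_of_mul_eq (F : IsQuotientRep lel ler f) (h : OrePair lel ler)
    {a z g w : S} {q t : T} (hz : z ∈ GS lel ler) (hza : ler z a) (hg : Hp lel ler g z)
    (hw : Rp ler w z) (hq : q = f z * t) (hgq : f g * q = f w) :
    IsQuotientBelow lel ler f a q := by
  have hG := h.mem_GS hz hg
  obtain ⟨l, hl⟩ := F.exists_inv hG
  refine ⟨g, hG, h.ler_trans hg.2.1 hza, w, h.Rp_trans hw hg.2.symm, l, hl, ?_⟩
  rw [← hgq, F.inv_mul_mul' hG hg.2.2 hl hq]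

theorem isQuotientBelow_inv_mul (F : IsQuotientRep lel ler f) (h : OrePair lel ler) {a y : S}
    {k : T} (ha : a ∈ GS lel ler) (hk : IsGroupInverse (f a) k) (hya : ler y a) :
    IsQuotientBelow lel ler f a (k * f y) := by
  obtain ⟨z, hz, s, hys, hzs, hza, hzz⟩ := h.exists_Rp_quotient ha hya
  obtain ⟨g, p, hg, hp, hpa, e, e'⟩ := F.exists_mul_inv_eq h ha hz hk hzz
  have hgz := h.Hp_mul hz hg (h.Hp_refl z)
  obtain ⟨m, -, -, l, -, em⟩ := F.exists_eq_mul_of_ler h (h.ler_refl y)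
  obtain ⟨t, ht⟩ := F.exists_inv_mul_eq h (t := f m * (l * f y)) ha hk hys.1 hzs.2
  rw [← em] at ht
  refine F.isQuotientBelow_of_mul_eq h (w := p * y) hz hza hgz ?_ ht ?_
  · exact h.mul_Rp_of_quotient hz hg hys hzs e
  · rw [F.map_mul, F.map_mul, ← e']
    simp only [mul_assoc]

theorem isQuotientBelow_inv_mul_quotient (F : IsQuotientRep lel ler f) (h : OrePair lel ler)
    {a x : S} {k q : T} (ha : a ∈ GS lel ler) (hk : IsGroupInverse (f a) k) (hxa : ler x a)
    (hq : IsQuotientBelow lel ler f x q) : IsQuotientBelow lel ler f a (k * q) := by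
  obtain ⟨w, hw, hwx, v, hvw, l, hl, rfl⟩ := hq
  obtain ⟨z, hz, s, hws, hzs, hza, hzz⟩ := h.exists_Rp_quotient ha (h.ler_trans hwx hxa)
  obtain ⟨g, p, hg, hp, hpa, e, e'⟩ := F.exists_mul_inv_eq h ha hz hk hzz
  have hpw := h.mul_Rp_of_quotient hz hg hws hzs e
  obtain ⟨g', y, hg', hy, hyw, -, e''⟩ := F.exists_mul_inv_eq h hw hz hl hpw
  have hgz := h.Hp_mul hz hg' (h.Hp_mul hz hg (h.Hp_refl z))
  have hlv : l * f v = f w * (l * l * f v) := by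
    rw [← mul_assoc, ← mul_assoc, hl.1, hl.2.2]
  obtain ⟨t, ht⟩ := F.exists_inv_mul_eq h (t := l * l * f v) ha hk hws.1 hzs.2
  rw [← hlv] at ht
  refine F.isQuotientBelow_of_mul_eq h (w := y * v) hz hza hgz ?_ ht ?_
  · exact h.Rp_trans (h.mul_Rp_left hw hyw hvw) hy
  · rw [F.map_mul, F.map_mul, F.map_mul, ← e'', ← e']
    simp only [mul_assoc]

theorem isQuotientBelow_mul (F : IsQuotientRep lel ler f) (h : OrePair lel ler)
    {a b : S} {p q : T} (hp : IsQuotientBelow lel ler f a p) (hq : IsQuotientBelow lel ler f b q) :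
    IsQuotientBelow lel ler f a (p * q) := by
  obtain ⟨z, hz, hza, v, hvz, k, hk, rfl⟩ := hp
  obtain ⟨w, hw, hwb, u, huw, l, hl, rfl⟩ := hq
  obtain ⟨c, hc, hvc⟩ := h.exists_Rp (v * w)
  obtain ⟨x, y, hx, hy, hyw, e, e'⟩ := F.exists_mul_inv_eq h hw hc hl hvc
  have hxG := h.mem_GS hc hx
  obtain ⟨n, hn⟩ := F.exists_inv hxG
  have hvl : f v * l = n * f y := by
    have : f v * l = f (v * w) * (l * l) := by
      rw [F.map_mul, mul_assoc, ← mul_assoc (f w), hl.1, hl.2.2]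
    rw [← e', F.inv_mul_mul' hxG (h.ler_trans hvc.1 hx.2.2) hn this]
  have hyx : ler (y * u) x :=
    h.ler_trans (h.mul_ler y u) (h.ler_trans hy.1 hx.2.2)
  have hxz : ler x z :=
    h.ler_trans hx.2.1 (h.ler_trans hvc.2 (h.ler_trans (h.mul_ler v w) hvz.1))
  have := F.isQuotientBelow_inv_mul_quotient h hz hk hxz (F.isQuotientBelow_inv_mul h hxG hn hyx)
  obtain ⟨z', hz', hz'z, H⟩ := this
  refine ⟨z', hz', h.ler_trans hz'z hza, ?_⟩
  convert H using 5
  rw [F.map_mul, ← mul_assoc n, ← hvl]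
  simp only [mul_assoc]

theorem isQuotientBelow_map (F : IsQuotientRep lel ler f) (h : OrePair lel ler) (s : S) :
    ∃ a, IsQuotientBelow lel ler f a (f s) := by
  obtain ⟨c, hc, hsc⟩ := h.exists_Rp s
  obtain ⟨k, hk⟩ := F.exists_inv hc
  refine ⟨c, ?_⟩
  have := F.isQuotientBelow_inv_mul h hc hk (h.mul_ler c s)
  rwa [F.map_mul, F.inv_mul_mul hc hsc.1 hk] at this

theorem isQuotientBelow_inv (F : IsQuotientRep lel ler f) (h : OrePair lel ler) {a : S} {k : T}
    (ha : a ∈ GS lel ler) (hk : IsGroupInverse (f a) k) :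
    ∃ b, IsQuotientBelow lel ler f b k := by
  refine ⟨a * a, ?_⟩
  have hk2 : IsGroupInverse (f (a * a)) (k * k) := by
    rw [F.map_mul]; exact hk.sq
  have := F.isQuotientBelow_inv_mul h (h.mem_GS ha (OrePair.Hp_symm ha)) hk2 ha.2.1
  rwa [mul_assoc, ← hk.1, ← mul_assoc, hk.2.2] at this

/-- The semigroup of straight left quotients of `S` in a representation of `S`. -/
def quotients (F : IsQuotientRep lel ler f) (h : OrePair lel ler) : Subsemigroup T where
  carrier := {q | ∃ a, IsQuotientBelow lel ler f a q}
  mul_mem' := fun ⟨a, ha⟩ ⟨_, hb⟩ => ⟨a, F.isQuotientBelow_mul h ha hb⟩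

theorem isGroupInverse_mk (F : IsQuotientRep lel ler f) (h : OrePair lel ler)
    {a k : F.quotients h} (hk : IsGroupInverse (a : T) (k : T)) : IsGroupInverse a k :=
  ⟨Subtype.ext hk.1, Subtype.ext hk.2.1, Subtype.ext hk.2.2⟩

theorem lel_of_eq_mul (F : IsQuotientRep lel ler f) (h : OrePair lel ler) {a b c : S} {q : T}
    (hq : IsQuotientBelow lel ler f a q) (e : f b = q * f c) : lel b c := by
  obtain ⟨z, hz, -, d, hdz, k, hk, rfl⟩ := hq
  have hbz : ler b z := F.ler_of_leR (Or.inr ⟨k * k * (f d * f c), by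
    rw [e, ← mul_assoc, ← mul_assoc (f z), hk.1, hk.2.2, mul_assoc]⟩)
  have e1 : f (z * b) = f (d * c) := by
    have := F.inv_mul_mul hz hdz.1 hk
    rw [F.map_mul, e, ← mul_assoc, ← mul_assoc, hk.1, mul_assoc k, this, F.map_mul]
  have := (h.mul_Lp hz hbz).2
  rw [F.injective e1] at this
  exact h.lel_trans this (h.mul_lel d c)

theorem straightLeftOrderExtension (F : IsQuotientRep lel ler f) (h : OrePair lel ler)
    (hS : SqSet S ⊆ GS lel ler) :
    StraightLeftOrderExtension lel ler (F.quotients h)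
      (fun s => ⟨f s, F.isQuotientBelow_map h s⟩) := by
  have hR : ∀ b c, ler b c ↔ leR (⟨f b, F.isQuotientBelow_map h b⟩ : F.quotients h)
      ⟨f c, F.isQuotientBelow_map h c⟩ := by
    refine fun b c => ⟨fun hbc => ?_, ?_⟩
    · obtain ⟨m, g, hg, k, hk, e⟩ := F.exists_eq_mul_of_ler h hbc
      exact Or.inr ⟨⟨f m, F.isQuotientBelow_map h m⟩ *
        (⟨k, F.isQuotientBelow_inv h hg hk⟩ * ⟨f b, F.isQuotientBelow_map h b⟩), Subtype.ext e⟩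
    · rintro (e | ⟨x, e⟩)
      · exact F.ler_of_leR (Or.inl (congrArg Subtype.val e))
      · exact F.ler_of_leR (Or.inr ⟨x, congrArg Subtype.val e⟩)
  refine ⟨fun a b e => F.injective (congrArg Subtype.val e),
    fun a b => Subtype.ext (F.map_mul a b), ?_, fun a ha => ?_,
    fun b c => ⟨⟨fun hbc => ?_, ?_⟩, hR b c⟩⟩
  · rintro ⟨q, a, z, hz, -, v, hvz, k, hk, rfl⟩
    exact ⟨z, v, ⟨⟨k, F.isQuotientBelow_inv h hz hk⟩, F.isGroupInverse_mk h hk, rfl⟩,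
      (hR z v).1 hvz.2, (hR v z).1 hvz.1⟩
  · obtain ⟨k, hk⟩ := F.exists_inv (hS ha)
    exact ⟨⟨k, F.isQuotientBelow_inv h (hS ha) hk⟩, F.isGroupInverse_mk h hk⟩
  · obtain ⟨m, g, hg, k, hk, e⟩ := F.exists_eq_mul_of_lel h hbc
    exact Or.inr ⟨⟨k, F.isQuotientBelow_inv h hg hk⟩ * ⟨f m, F.isQuotientBelow_map h m⟩,
      Subtype.ext e⟩
  · rintro (e | ⟨⟨x, a, hx⟩, e⟩)
    · rw [F.injective (congrArg Subtype.val e)]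
      exact h.lel_refl c
    · exact F.lel_of_eq_mul h hx (congrArg Subtype.val e)

end IsQuotientRep

/-! ### Pairs of transformations -/

/-- Pairs of a transformation of `X`, acting on the right, and one of `Y`, acting on the left. -/
@[ext]
structure BiEnd (X Y : Type u) : Type u where
  /-- the right action -/
  right : X → X
  /-- the left action -/
  left : Y → Y

instance (X Y : Type u) : Semigroup (BiEnd X Y) where
  mul p q := ⟨q.right ∘ p.right, p.left ∘ q.left⟩
  mul_assoc _ _ _ := rfl

theorem inSubgroup_of_eq_mul_sq [Semigroup Q] {r y z : Q} (hy : r = y * (r * r))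
    (hz : r = r * r * z) : inSubgroup r := by
  have e : y * r = r * z := by
    calc y * r = y * (r * r * z) := by rw [← hz]
      _ = y * (r * r) * z := by rw [mul_assoc y]
      _ = r * z := by rw [← hy]
  have e1 : r * (r * z * z) = r * z := by rw [← mul_assoc, ← mul_assoc, ← hz]
  have e2 : r * z * z * r = r * z := by
    rw [← e, mul_assoc y r z, ← e, mul_assoc, mul_assoc, ← hy]
  refine ⟨r * z * z, by rw [e1, e2], ?_, ?_⟩
  · rw [e1, ← e, mul_assoc, ← hy]
  · have e3 : r * z * r = r := by rw [← e, mul_assoc, ← hy]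
    rw [e2, mul_assoc r z z, ← mul_assoc (r * z), e3]

theorem Function.exists_comp_sq {X : Type*} {g : X → X}
    (hinj : ∀ x x', g (g x) = g (g x') → g x = g x') (hsurj : ∀ x, ∃ x', g x = g (g x')) :
    ∃ y z : X → X, g = y ∘ (g ∘ g) ∧ g = (g ∘ g) ∘ z := by
  choose z hz using hsurj
  have hf : Function.FactorsThrough g (g ∘ g) := fun x x' e => hinj x x' e
  exact ⟨Function.extend (g ∘ g) g id, z, funext fun x => (hf.extend_apply id x).symm,
    funext hz⟩

theorem BiEnd.inSubgroup {X Y : Type u} {r : BiEnd X Y}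
    (h1 : ∀ x x', r.right (r.right x) = r.right (r.right x') → r.right x = r.right x')
    (h2 : ∀ x, ∃ x', r.right x = r.right (r.right x'))
    (h3 : ∀ x x', r.left (r.left x) = r.left (r.left x') → r.left x = r.left x')
    (h4 : ∀ x, ∃ x', r.left x = r.left (r.left x')) : inSubgroup r := by
  obtain ⟨y, z, hy, hz⟩ := Function.exists_comp_sq h1 h2
  obtain ⟨y', z', hy', hz'⟩ := Function.exists_comp_sq h3 h4
  exact inSubgroup_of_eq_mul_sq (y := ⟨z, y'⟩) (z := ⟨y, z'⟩) (BiEnd.ext hz hy')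
    (BiEnd.ext hy hz')

/-! ### The representation of `S` on formal left quotients -/

/-- Formal left quotients `a♯ * b` with `a ∈ G(S)` and `b ≤_r a`. -/
def PreQuotient [Semigroup S] (lel ler : S → S → Prop) : Type u :=
  { p : S × S // p.1 ∈ GS lel ler ∧ ler p.2 p.1 }

namespace PreQuotient

variable [Semigroup S] {lel ler : S → S → Prop}

/-- The denominator. -/
def den (p : PreQuotient lel ler) : S := p.1.1

/-- The numerator. -/
def num (p : PreQuotient lel ler) : S := p.1.2

theorem den_mem (p : PreQuotient lel ler) : p.den ∈ GS lel ler := p.2.1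

theorem num_ler (p : PreQuotient lel ler) : ler p.num p.den := p.2.2

/-- A formal left quotient which is not straight represents zero. -/
def Straight (p : PreQuotient lel ler) : Prop := ler p.den p.num

/-- `p` and `q` have a common expansion. -/
def Equiv (p q : PreQuotient lel ler) : Prop :=
  Hp lel ler p.den q.den ∧ ∃ u v, Hp lel ler u p.den ∧ Hp lel ler v p.den ∧
    u * p.den = v * q.den ∧ u * p.num = v * q.num

/-- `p` and `q` represent the same element. -/
def Rel (p q : PreQuotient lel ler) : Prop := (¬ p.Straight ∧ ¬ q.Straight) ∨ p.Equiv q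

theorem ler_mul_iff (h : OrePair lel ler) {a b u : S} (ha : a ∈ GS lel ler) (hb : ler b a)
    (hu : Hp lel ler u a) : ler a (u * b) ↔ ler a b := by
  have hua : Rp ler (u * a) a := (h.Hp_mul ha hu (h.Hp_refl a)).2
  refine ⟨fun hab => ?_, fun hab => h.ler_trans hua.2 (h.ler_mul u hab)⟩
  exact (h.Rp_cancel (h.mem_GS ha hu) hu.2.2 (h.ler_trans hb hu.2.2)
    ⟨h.ler_trans hua.1 hab, h.ler_mul u hb⟩).1

theorem Equiv.straight_iff (h : OrePair lel ler) {p q : PreQuotient lel ler} (hpq : p.Equiv q) :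
    p.Straight ↔ q.Straight := by
  obtain ⟨hH, u, v, hu, hv, -, e⟩ := hpq
  have h1 := ler_mul_iff h p.den_mem p.num_ler hu
  have h2 := ler_mul_iff h q.den_mem q.num_ler (h.Hp_trans hv hH)
  rw [Straight, Straight, ← h1, ← h2, e]
  exact ⟨h.ler_trans hH.2.2, h.ler_trans hH.2.1⟩

theorem Equiv.refl (h : OrePair lel ler) (p : PreQuotient lel ler) : p.Equiv p :=
  ⟨h.Hp_refl _, p.den, p.den, h.Hp_refl _, h.Hp_refl _, rfl, rfl⟩

theorem Equiv.symm (h : OrePair lel ler) {p q : PreQuotient lel ler} (hpq : p.Equiv q) :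
    q.Equiv p := by
  obtain ⟨hH, u, v, hu, hv, e, e'⟩ := hpq
  exact ⟨OrePair.Hp_symm hH, v, u, h.Hp_trans hv hH, h.Hp_trans hu hH, e.symm, e'.symm⟩

theorem Equiv.trans (h : OrePair lel ler) {p q r : PreQuotient lel ler} (hpq : p.Equiv q)
    (hqr : q.Equiv r) : p.Equiv r := by
  obtain ⟨hH, u, v, hu, hv, e, e'⟩ := hpq
  obtain ⟨hH', u', v', hu', hv', d, d'⟩ := hqr
  have hH1 := OrePair.Hp_symm hH
  obtain ⟨s, t, hs, ht, est⟩ := h.ore p.den_mem hv (h.Hp_trans hu' hH1)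
  refine ⟨h.Hp_trans hH hH', s * u, t * v', h.Hp_mul p.den_mem hs hu,
    h.Hp_mul p.den_mem ht (h.Hp_trans hv' hH1), ?_, ?_⟩
  · rw [mul_assoc, e, ← mul_assoc, est, mul_assoc, d, mul_assoc]
  · rw [mul_assoc, e', ← mul_assoc, est, mul_assoc, d', mul_assoc]

/-- The setoid of formal left quotients representing the same element. -/
def setoid (h : OrePair lel ler) : Setoid (PreQuotient lel ler) where
  r := Rel
  iseqv :=
    { refl := fun p => Or.inr (Equiv.refl h p)
      symm := by
        rintro p q (⟨h1, h2⟩ | hpq)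
        · exact Or.inl ⟨h2, h1⟩
        · exact Or.inr (hpq.symm h)
      trans := by
        rintro p q r (⟨h1, h2⟩ | hpq) (⟨h3, h4⟩ | hqr)
        · exact Or.inl ⟨h1, h4⟩
        · exact Or.inl ⟨h1, fun hr => h2 ((hqr.straight_iff h).2 hr)⟩
        · exact Or.inl ⟨fun hp => h3 ((hpq.straight_iff h).1 hp), h4⟩
        · exact Or.inr (hpq.trans h hqr) }

/-- Right multiplication of a formal left quotient by an element of `S`. -/
def act (h : OrePair lel ler) (s : S) (p : PreQuotient lel ler) : PreQuotient lel ler :=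
  ⟨(p.den, p.num * s), p.den_mem, h.ler_trans (h.mul_ler _ s) p.num_ler⟩

theorem num_act (h : OrePair lel ler) (s : S) (p : PreQuotient lel ler) :
    (act h s p).num = p.num * s := rfl

theorem act_mul (h : OrePair lel ler) (s t : S) (p : PreQuotient lel ler) :
    act h (s * t) p = act h t (act h s p) :=
  Subtype.ext (Prod.ext rfl (mul_assoc _ _ _).symm)

theorem Rel.act (h : OrePair lel ler) (s : S) {p q : PreQuotient lel ler} (hpq : p.Rel q) :
    (act h s p).Rel (act h s q) := by
  obtain ⟨h1, h2⟩ | ⟨hH, u, v, hu, hv, e, e'⟩ := hpq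
  · exact Or.inl ⟨fun hp => h1 (h.ler_trans hp (h.mul_ler _ s)),
      fun hq => h2 (h.ler_trans hq (h.mul_ler _ s))⟩
  · exact Or.inr ⟨hH, u, v, hu, hv, e, by
      rw [num_act, num_act, ← mul_assoc, e', mul_assoc]⟩

theorem Rel.act_of_ler (h : OrePair lel ler) {w x : S} (hwx : ler w x)
    {p q : PreQuotient lel ler} (hpq : (PreQuotient.act h x p).Rel (PreQuotient.act h x q)) :
    (PreQuotient.act h w p).Rel (PreQuotient.act h w q) := by
  obtain ⟨h1, h2⟩ | ⟨hH, u, v, hu, hv, e, e'⟩ := hpq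
  · exact Or.inl ⟨fun hp => h1 (h.ler_trans hp (h.ler_mul _ hwx)),
      fun hq => h2 (h.ler_trans hq (h.ler_mul _ hwx))⟩
  · refine Or.inr ⟨hH, u, v, hu, hv, e, ?_⟩
    rw [num_act, num_act, ← mul_assoc, ← mul_assoc] at e' ⊢
    exact h.cancel hwx e'

theorem exists_rel_act_act (h : OrePair lel ler) {a : S} (ha : a ∈ GS lel ler)
    (p : PreQuotient lel ler) :
    ∃ q, (PreQuotient.act h a p).Rel (PreQuotient.act h a (PreQuotient.act h a q)) := by
  by_cases hp : (PreQuotient.act h a p).Straight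
  · have hc : Rp ler (p.num * a) p.den := ⟨(PreQuotient.act h a p).num_ler, hp⟩
    obtain ⟨x, y, hx, hy, -, e⟩ := h.exists_quotient ha p.den_mem hc
    have hxd := h.Hp_mul p.den_mem hx (h.Hp_refl _)
    refine ⟨⟨(x * p.den, y), h.mem_GS p.den_mem hxd, h.ler_trans hy.1 hxd.2.2⟩, Or.inr ?_⟩
    refine ⟨OrePair.Hp_symm hxd, p.den * x, p.den, h.Hp_mul p.den_mem (h.Hp_refl _) hx,
      h.Hp_refl _, mul_assoc _ _ _, ?_⟩
    change p.den * x * (p.num * a) = p.den * (y * a * a)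
    rw [mul_assoc, e]
  · exact ⟨p, Or.inl ⟨hp, fun hq => hp (h.ler_trans hq (h.mul_ler _ a))⟩⟩

end PreQuotient

namespace OrePair

variable [Semigroup S] {lel ler : S → S → Prop}

/-- The setoid of `R'`-related elements. -/
def rpSetoid (h : OrePair lel ler) : Setoid S where
  r := Rp ler
  iseqv := ⟨h.Rp_refl, fun e => e.symm, h.Rp_trans⟩

/-- The representation of `S` by its right action on formal left quotients and its left action on
`R'`-classes. -/
def rep (h : OrePair lel ler) (s : S) :
    BiEnd (Quotient (PreQuotient.setoid h)) (Quotient h.rpSetoid) where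
  right := Quotient.map (PreQuotient.act h s) fun _ _ e => PreQuotient.Rel.act h s e
  left := Quotient.map (s * ·) fun _ _ e => h.Rp_mul s e

theorem rep_mul (h : OrePair lel ler) (s t : S) : h.rep (s * t) = h.rep s * h.rep t := by
  refine BiEnd.ext (funext fun x => ?_) (funext fun y => ?_)
  · induction x using Quotient.inductionOn with
    | h p => exact congrArg (Quotient.mk _) (PreQuotient.act_mul h s t p)
  · induction y using Quotient.inductionOn with
    | h c => exact congrArg (Quotient.mk _) (mul_assoc s t c)

theorem rep_right_eq (h : OrePair lel ler) {w x : S} (hwx : ler w x)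
    {ξ η : Quotient (PreQuotient.setoid h)} (e : (h.rep x).right ξ = (h.rep x).right η) :
    (h.rep w).right ξ = (h.rep w).right η := by
  induction ξ using Quotient.inductionOn with
  | h p =>
    induction η using Quotient.inductionOn with
    | h q => exact Quotient.sound (PreQuotient.Rel.act_of_ler h hwx (Quotient.exact e))

theorem inSubgroup_rep (h : OrePair lel ler) {a : S} (ha : a ∈ GS lel ler) :
    inSubgroup (h.rep a) := by
  refine BiEnd.inSubgroup (fun x x' e => ?_) (fun x => ?_) (fun y y' e => ?_) (fun y => ?_)
  · refine h.rep_right_eq ha.2.1 ?_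
    rw [h.rep_mul]
    exact e
  · induction x using Quotient.inductionOn with
    | h p =>
      obtain ⟨q, hq⟩ := PreQuotient.exists_rel_act_act h ha p
      exact ⟨Quotient.mk _ q, Quotient.sound hq⟩
  · induction y using Quotient.inductionOn with
    | h s =>
      induction y' using Quotient.inductionOn with
      | h t =>
        exact Quotient.sound
          (h.Rp_cancel ha (h.mul_ler a s) (h.mul_ler a t) (Quotient.exact e))
  · induction y using Quotient.inductionOn with
    | h s =>
      obtain ⟨d, hd⟩ := h.ler_iff.1 (h.ler_trans (h.mul_ler a s) ha.2.1)
      rw [mul_assoc] at hd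
      exact ⟨Quotient.mk _ d, Quotient.sound hd⟩

theorem ler_of_leR_rep (h : OrePair lel ler) {b c : S} (hbc : leR (h.rep b) (h.rep c)) :
    ler b c := by
  obtain ⟨g, hg, hbg⟩ := h.exists_Lp b
  have hb : Rp ler (b * g) b := h.mul_Rp hg hbg.1
  obtain e | ⟨x, e⟩ := hbc
  · have e1 : (h.rep b).left (Quotient.mk _ g) = (h.rep c).left (Quotient.mk _ g) := by rw [e]
    have e2 : Rp ler (b * g) (c * g) := Quotient.exact e1
    exact h.ler_trans hb.2 (h.ler_trans e2.1 (h.mul_ler c g))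
  · obtain ⟨t, ht⟩ := Quotient.exists_rep (x.left (Quotient.mk _ g))
    have e1 : (h.rep b).left (Quotient.mk _ g) = (h.rep c).left (Quotient.mk _ t) := by
      rw [ht, e]; rfl
    have e2 : Rp ler (b * g) (c * t) := Quotient.exact e1
    exact h.ler_trans hb.2 (h.ler_trans e2.1 (h.mul_ler c t))

theorem rep_injective (h : OrePair lel ler) : Function.Injective h.rep := by
  intro b c e
  have hbc : Rp ler b c := ⟨h.ler_of_leR_rep (Or.inl e), h.ler_of_leR_rep (Or.inl e.symm)⟩
  obtain ⟨g, hg, hbg⟩ := h.exists_Rp b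
  let p : PreQuotient lel ler := ⟨(g, g), hg, h.ler_refl g⟩
  have e1 : (h.rep b).right (Quotient.mk _ p) = (h.rep c).right (Quotient.mk _ p) := by rw [e]
  have hgb : Rp ler (g * b) g := h.mul_Rp_left hg (h.lel_refl g) hbg
  obtain ⟨h1, -⟩ | ⟨-, u, v, hu, hv, e2, e3⟩ :
      PreQuotient.Rel (PreQuotient.act h b p) (PreQuotient.act h c p) := Quotient.exact e1
  · exact absurd hgb.2 h1
  · change u * g = v * g at e2
    change u * (g * b) = v * (g * c) at e3
    have huv : u = v := h.right_cancel hg hu.1.1 hv.1.1 e2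
    subst huv
    have hug := h.Hp_mul hg hu (h.Hp_refl g)
    have hbu : ler b (u * g) := h.ler_trans hbg.1 hug.2.2
    rw [← mul_assoc, ← mul_assoc] at e3
    exact h.left_cancel (h.mem_GS hg hug) hbu (h.ler_trans hbc.2 hbu) e3

theorem isQuotientRep_rep (h : OrePair lel ler) : IsQuotientRep lel ler h.rep where
  map_mul := h.rep_mul
  injective := h.rep_injective
  exists_inv := h.inSubgroup_rep
  ler_of_leR := h.ler_of_leR_rep
  inv_mul_mul := by
    intro a b k ha hba hk
    have e : k * h.rep a * h.rep a = h.rep a := by rw [← hk.1, hk.2.1]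
    refine BiEnd.ext (funext fun x => ?_) (funext fun y => ?_)
    · refine h.rep_right_eq hba (ξ := (h.rep a).right (k.right x)) (η := x) ?_
      exact congrFun (congrArg BiEnd.right e) x
    · induction y using Quotient.inductionOn with
      | h s =>
        obtain ⟨t, ht⟩ := h.ler_iff.1 (h.ler_trans (h.mul_ler b s) hba)
        have e1 : (h.rep b).left (Quotient.mk _ s) = (h.rep a).left (Quotient.mk _ t) :=
          Quotient.sound ht
        change k.left ((h.rep a).left ((h.rep b).left (Quotient.mk _ s))) = _
        rw [e1]
        exact congrFun (congrArg BiEnd.left e) (Quotient.mk _ t)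

end OrePair

/-! ### Conditions forced by a straight left order extension -/

theorem IsGroupInverse.mul_mul_of_leR [Semigroup Q] {p q k : Q} (hk : IsGroupInverse q k)
    (hp : leR p q) : q * (k * p) = p := by
  obtain rfl | ⟨x, rfl⟩ := hp
  · rw [← mul_assoc, hk.2.1]
  · rw [← mul_assoc, ← mul_assoc, hk.2.1]

theorem IsGroupInverse.mul_mul_of_leL [Semigroup Q] {p q k : Q} (hk : IsGroupInverse q k)
    (hp : leL p q) : p * k * q = p := by
  obtain rfl | ⟨x, rfl⟩ := hp
  · exact hk.2.1
  · rw [mul_assoc x, mul_assoc x, hk.2.1]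

namespace IsEmbeddableStarPair

variable [Semigroup S] {lel ler : S → S → Prop}

theorem GS_subset_SqSet (h : IsEmbeddableStarPair lel ler) : GS lel ler ⊆ SqSet S := by
  obtain ⟨⟨-, -, -, -, -, -, hl, hr⟩, -⟩ := h
  exact fun a ha => ⟨hl _ _ ha.1.1, hl _ _ ha.1.2, hr _ _ ha.2.1, hr _ _ ha.2.2⟩

theorem Hp_mul (h : IsEmbeddableStarPair lel ler) {a x y : S} (ha : a ∈ GS lel ler)
    (hx : Hp lel ler x a) (hy : Hp lel ler y a) : Hp lel ler (x * y) a := by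
  obtain ⟨⟨-, lt, -, rt, lm, rm, -⟩, -, -, -, -, e1, e2, -⟩ := h
  have h1 := e1 a ha x hx.1.1
  have h2 := e2 a ha y hy.2.1
  exact ⟨⟨lt _ _ _ (lt _ _ _ (lm _ _ y hx.1.1) h2.1) hy.1.1,
      lt _ _ _ hy.1.2 (lt _ _ _ h2.2 (lm _ _ y hx.1.2))⟩,
    rt _ _ _ (rt _ _ _ (rm _ _ x hy.2.1) h1.1) hx.2.1,
    rt _ _ _ hx.2.2 (rt _ _ _ h1.2 (rm _ _ x hy.2.2))⟩

theorem mem_GS (h : IsEmbeddableStarPair lel ler) {a x : S} (ha : a ∈ GS lel ler)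
    (hx : Hp lel ler x a) : x ∈ GS lel ler := by
  have hxx := h.Hp_mul ha hx hx
  obtain ⟨⟨-, lt, -, rt, -⟩, -⟩ := h
  exact ⟨⟨lt _ _ _ hx.1.1 hxx.1.2, lt _ _ _ hxx.1.1 hx.1.2⟩,
    rt _ _ _ hx.2.1 hxx.2.2, rt _ _ _ hxx.2.1 hx.2.2⟩

end IsEmbeddableStarPair

namespace StraightLeftOrderExtension

variable [Semigroup S] {lel ler : S → S → Prop} [Semigroup Q] {f : S → Q}

theorem mem_GS (E : StraightLeftOrderExtension lel ler Q f) {a : S} (ha : inSubgroup (f a)) :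
    a ∈ GS lel ler := by
  obtain ⟨-, hmul, -, -, hP⟩ := E
  obtain ⟨k, h1, h2, -⟩ := ha
  refine ⟨⟨(hP _ _).1.2 (Or.inr ⟨k, ?_⟩), (hP _ _).1.2 (Or.inr ⟨f a, hmul a a⟩)⟩,
    (hP _ _).2.2 (Or.inr ⟨k, ?_⟩), (hP _ _).2.2 (Or.inr ⟨f a, hmul a a⟩)⟩
  · rw [hmul, ← mul_assoc, ← h1, h2]
  · rw [hmul, mul_assoc, h1, ← mul_assoc, h2]

theorem condGi (E : StraightLeftOrderExtension lel ler Q f) (h : IsEmbeddableStarPair lel ler) :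
    CondGi lel ler :=
  Set.Subset.antisymm (fun a ha => E.mem_GS (E.2.2.2.1 a ha)) h.GS_subset_SqSet

theorem condGii (E : StraightLeftOrderExtension lel ler Q f) (h : IsEmbeddableStarPair lel ler) :
    CondGii lel ler := by
  intro a has x y hx hy
  have ha : a ∈ GS lel ler := E.mem_GS (E.2.2.2.1 a has)
  have hyG := h.mem_GS ha hy
  obtain ⟨i, hi⟩ := E.2.2.2.1 a has
  obtain ⟨j, hj⟩ := E.2.2.2.1 y (h.GS_subset_SqSet hyG)
  have hGS := fun {s} => E.mem_GS (a := s)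
  obtain ⟨hinj, hmul, hq, -, hP⟩ := E
  obtain ⟨c, d, ⟨k, hk, e⟩, hcd⟩ := hq (f a * f x * j)
  have hc : c ∈ GS lel ler := hGS ⟨k, hk⟩
  have e1 : f c * (f a * f x * j) = f d := by rw [e, hk.mul_mul_of_leR hcd.2]
  have he := h
  obtain ⟨⟨lr, lt, -, rt, -, rm, -⟩, -, -, -, -, -, e2, -, -, e3, -⟩ := h
  have hxy : lel x y := lt _ _ _ hx.1.1 hy.1.2
  have e4 : f x * j * f y = f x := hj.mul_mul_of_leL ((hP _ _).1.1 hxy)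
  have e5 : c * a * x = d * y := hinj (by
    rw [hmul d, ← e1, mul_assoc (f c), mul_assoc (f a), mul_assoc (f a), e4, hmul, hmul,
      mul_assoc])
  have hca : ler c a := by
    refine (hP _ _).2.2 ?_
    have e6 : k * f c * f c = f c := by rw [← hk.1, hk.2.1]
    obtain e7 | ⟨t, e7⟩ := hcd.1
    · exact Or.inr ⟨f x * j * f c, by
        rw [← mul_assoc, ← mul_assoc, e, ← e7, e6]⟩
    · exact Or.inr ⟨f x * j * (t * f c), by
        rw [← mul_assoc, ← mul_assoc, ← mul_assoc, e, mul_assoc k, ← e7, e6]⟩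
  have hac : ler a c := by
    refine (hP _ _).2.2 ?_
    have e6 : f a * f x * j * f y = f a * f x := by rw [mul_assoc (f a), mul_assoc (f a), e4]
    have e7 : f a * f a * i = f a := by rw [mul_assoc, hi.1, ← mul_assoc, hi.2.1]
    have e8 : f c * k * k = k := by rw [hk.1, hk.2.2]
    have e9 : f a * f x = f c * (k * k * f d * f y) := by
      rw [← e6, e, ← mul_assoc, ← mul_assoc, ← mul_assoc, e8]
    obtain e7' | ⟨t, e7'⟩ := (hP _ _).2.1 hx.2.2
    · exact Or.inr ⟨k * k * f d * f y * i, by rw [← mul_assoc, ← e9, ← e7', e7]⟩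
    · exact Or.inr ⟨k * k * f d * f y * (t * i), by
        rw [← mul_assoc, ← e9, mul_assoc (f a), ← mul_assoc (f x), ← e7', ← mul_assoc, e7]⟩
  have hcaH : Hp lel ler (c * a) a :=
    ⟨e2 c hc a hac, rt _ _ _ (rm _ _ c hac) (rt _ _ _ hc.2.2 hca),
      rt _ _ _ hac (rt _ _ _ hc.2.1 (rm _ _ c hca))⟩
  have hdy : Hp lel ler (d * y) a := by
    rw [← e5]
    exact he.Hp_mul ha hcaH hx
  have e8 : j * j * f y = j := by rw [mul_assoc, ← hj.1, ← mul_assoc, hj.2.2]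
  have hly : lel d y := (hP _ _).1.2 (Or.inr ⟨f c * (f a * f x) * (j * j), by
    rw [← e1, mul_assoc _ (j * j), e8, mul_assoc (f c)]⟩)
  have hdyL : Lp lel d y := e3 y hyG d y hly (lr y)
    ⟨lt _ _ _ hdy.1.1 (lt _ _ _ hy.1.2 hyG.1.1), lt _ _ _ hyG.1.2 (lt _ _ _ hy.1.1 hdy.1.2)⟩
  refine ⟨c * a, d, hcaH, ⟨⟨lt _ _ _ hdyL.1 hy.1.1, lt _ _ _ hy.1.2 hdyL.2⟩, ?_, ?_⟩, e5⟩
  · exact rt _ _ _ ((hP _ _).2.2 hcd.2) hca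
  · exact rt _ _ _ hac ((hP _ _).2.2 hcd.1)

end StraightLeftOrderExtension

/-- Theorem 4.4: let `S` be a semigroup having an embeddable `*`-pair `(lel, ler)`.
Then there is a semigroup `Q` containing `S` as a subsemigroup such that `S` is a
straight left order in `Q` and `Q` induces `(lel, ler)`, if and only if `(lel, ler)`
satisfies (Gi) and (Gii). -/
theorem straight_left_order_iff_Gi_Gii {S : Type u} [Semigroup S]
    (lel ler : S → S → Prop) (hemb : IsEmbeddableStarPair lel ler) :
    (∃ (Q : Type u) (iQ : Semigroup Q) (f : S → Q),
      @StraightLeftOrderExtension S _ lel ler Q iQ f) ↔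
    (CondGi lel ler ∧ CondGii lel ler) := by
  constructor
  · rintro ⟨Q, iQ, f, E⟩
    exact ⟨E.condGi hemb, E.condGii hemb⟩
  · rintro ⟨hi, hii⟩
    have h := hemb.orePair hi hii
    exact ⟨h.isQuotientRep_rep.quotients h, inferInstance, _,
      h.isQuotientRep_rep.straightLeftOrderExtension h hi.le⟩
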